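/- arXiv:math/0506031 — 2 statements merged into one kernel-verified Lean document; each statement's English description precedes it below -/
import Mathlib

section
/- If X is a compact metric space, then the Chabauty topology on the collection of closed subsets of X coincides with the topology induced by the Hausdorff extended distance on closed subsets of X. -/
/-- The sub-basis for the Chabauty topology on the collection of closed subsets
of a topological space `X`: the sets `O₁(K) = {A closed : A ∩ K = ∅}` for `K`
compact, and `O₂(U) = {A closed : A ∩ U ≠ ∅}` for `U` open. -/
def chabautySubbasis (X : Type*) [TopologicalSpace X] :
    Set (Set {A : Set X // IsClosed A}) :=
  {s | (∃ K : Set X, IsCompact K ∧ s = {A | A.1 ∩ K = ∅}) ∨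
       (∃ U : Set X, IsOpen U ∧ s = {A | (A.1 ∩ U).Nonempty})}

/-- The Chabauty topology on the collection of closed subsets of `X`. -/
def chabautyTopology (X : Type*) [TopologicalSpace X] :
    TopologicalSpace {A : Set X // IsClosed A} :=
  TopologicalSpace.generateFrom (chabautySubbasis X)

/-- The pseudo-extended-metric structure on the collection of closed subsets of
a metric space `X` given by the Hausdorff extended distance. -/
noncomputable def hausdorffPseudoEMetric (X : Type*) [MetricSpace X] :
    PseudoEMetricSpace {A : Set X // IsClosed A} where
  edist A B := EMetric.hausdorffEdist A.1 B.1
  edist_self A := EMetric.hausdorffEdist_self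
  edist_comm A B := EMetric.hausdorffEdist_comm
  edist_triangle A B C := EMetric.hausdorffEdist_triangle

/-- On the closed subsets of a compact Hausdorff space, the Chabauty topology is the restriction
of the Vietoris topology. -/
theorem chabautyTopology_eq_induced_vietoris (X : Type*) [TopologicalSpace X] [CompactSpace X]
    [T2Space X] :
    chabautyTopology X = (TopologicalSpace.vietoris X).induced Subtype.val := by
  rw [TopologicalSpace.vietoris, induced_generateFrom_eq, chabautyTopology]
  congr 1
  ext s
  constructor
  · rintro (⟨K, hK, rfl⟩ | ⟨U, hU, rfl⟩)
    · refine ⟨_, .inl ⟨Kᶜ, hK.isClosed.isOpen_compl, rfl⟩, ?_⟩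
      ext A
      exact Set.subset_compl_iff_disjoint_right.trans Set.disjoint_iff_inter_eq_empty
    · exact ⟨_, .inr ⟨U, hU, rfl⟩, rfl⟩
  · rintro ⟨_, ⟨U, hU, rfl⟩ | ⟨U, hU, rfl⟩, rfl⟩
    · refine .inl ⟨Uᶜ, hU.isClosed_compl.isCompact, ?_⟩
      ext A
      exact Set.disjoint_compl_right_iff_subset.symm.trans Set.disjoint_iff_inter_eq_empty
    · exact .inr ⟨U, hU, rfl⟩

/-- The Hausdorff structure on closed subsets is the restriction of the one on all subsets. -/
theorem hausdorffPseudoEMetric_eq_induced (X : Type*) [MetricSpace X] :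
    hausdorffPseudoEMetric X =
      PseudoEMetricSpace.induced Subtype.val (PseudoEMetricSpace.hausdorff (α := X)) :=
  PseudoEMetricSpace.ext rfl

/-- For a compact metric space `X`, the Chabauty topology on the closed subsets
of `X` coincides with the topology induced by the Hausdorff extended distance. -/
theorem chabauty_eq_hausdorff (X : Type*) [MetricSpace X] [CompactSpace X] :
    chabautyTopology X = (hausdorffPseudoEMetric X).toUniformSpace.toTopologicalSpace := by
  rw [chabautyTopology_eq_induced_vietoris, hausdorffPseudoEMetric_eq_induced]
  refine TopologicalSpace.ext_nhds fun A => ?_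
  rw [@nhds_induced _ _ (.vietoris X) Subtype.val A,
    ← A.2.isCompact.nhds_hausdorff_eq_nhds_vietoris]
  exact (@nhds_induced _ _ (UniformSpace.hausdorff X).toTopologicalSpace Subtype.val A).symm
end

section
/- Let b, b', c, c' be pairs of real numbers (endpoint data of lifted arcs in the annulus), with the algebraic intersection number defined by a·b = ⌊b_1 − a_1⌋ − ⌊b_0 − a_0⌋. If b'·b = 0 and c·c' = 0, then |b'·c' − b·c| ≤ 2. (This is the bound diam(τ_α(β,γ)) ≤ 2 for the relative twist number: any two lifts b, b' of the same simple closed curve β, and any two lifts c, c' of the same simple closed curve γ, have disjoint interiors, hence pairwise algebraic intersection number 0, so all the numbers b·c occurring in τ_α(β,γ) differ by at most 2.) -/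
/-- The algebraic intersection number of two arcs in the annulus, computed from
the endpoint data `a = (a₀, a₁)`, `b = (b₀, b₁)` of lifts to the cover `ℝ × [0,1]`:
`a·b = ⌊b₁ − a₁⌋ − ⌊b₀ − a₀⌋`. -/
noncomputable def annulusDot (a b : ℝ × ℝ) : ℤ :=
  ⌊b.2 - a.2⌋ - ⌊b.1 - a.1⌋

/-- The defect of the floor function from additivity on a sum of three terms is `0`, `1` or `2`. -/
theorem floor_add_three_sub_mem_Icc (x y z : ℝ) :
    ⌊x + y + z⌋ - (⌊x⌋ + ⌊y⌋ + ⌊z⌋) ∈ Set.Icc (0 : ℤ) 2 := by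
  have h₁ := Int.le_floor_add x y
  have h₂ := Int.le_floor_add_floor x y
  have h₃ := Int.le_floor_add (x + y) z
  have h₄ := Int.le_floor_add_floor (x + y) z
  constructor <;> omega

/-- If `b'·b = 0` and `c·c' = 0` (e.g. `b, b'` are lifts of one simple closed
curve and `c, c'` lifts of another, so each pair has disjoint interiors), then
`|b'·c' − b·c| ≤ 2`.  This is the bound `diam (τ_α(β,γ)) ≤ 2` for the relative
twist number. -/
theorem annulusDot_diam_le_two (b b' c c' : ℝ × ℝ)
    (hb : annulusDot b' b = 0) (hc : annulusDot c c' = 0) :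
    |annulusDot b' c' - annulusDot b c| ≤ 2 := by
  obtain ⟨l₁, u₁⟩ := floor_add_three_sub_mem_Icc (b.1 - b'.1) (c.1 - b.1) (c'.1 - c.1)
  obtain ⟨l₂, u₂⟩ := floor_add_three_sub_mem_Icc (b.2 - b'.2) (c.2 - b.2) (c'.2 - c.2)
  have telescope (p q r s : ℝ) : q - p + (r - q) + (s - r) = s - p := by ring
  rw [telescope] at l₁ u₁ l₂ u₂
  unfold annulusDot at *
  rw [abs_le]
  constructor <;> omega
end
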